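/- arXiv:1301.5492 — 4 statements merged into one kernel-verified Lean document; each statement's English description precedes it below -/
import Mathlib

section
/- Let α > 0, C > 0 and ρ ≥ 0 be real numbers, let (γ_n)_{n∈ℕ} be positive reals with γ_n → 0, let (F_n)_{n∈ℕ} be positive reals with F_n → ∞, and let (a_n)_{n∈ℕ} be nonnegative reals such that a_n ≤ C·(γ_n·k + k^{2ρ}/F_n² + k^{−2α}) for every n ∈ ℕ and every real k > 0. Then there exists a constant C' > 0 such that a_n ≤ C'·(γ_n^{2α/(2α+1)} + F_n^{−2α/(α+ρ)}) for all n ∈ ℕ. -/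
open Filter

/-- **Deterministic balancing lemma for the three error terms.**
If `a_n ≤ C (γ_n k + k^{2ρ}/F_n² + k^{−2α})` for all `n` and all `k > 0`, where
`γ_n → 0` and `F_n → ∞`, then `a_n ≤ C' (γ_n^{2α/(2α+1)} + F_n^{−2α/(α+ρ)})` for some
constant `C' > 0` and all `n`. -/
theorem balancing_rates (α C ρ : ℝ) (hα : 0 < α) (hC : 0 < C) (hρ : 0 ≤ ρ)
    (γ F a : ℕ → ℝ)
    (hγpos : ∀ n, 0 < γ n) (hγ : Tendsto γ atTop (nhds 0))
    (hFpos : ∀ n, 0 < F n) (hF : Tendsto F atTop atTop)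
    (ha : ∀ n, 0 ≤ a n)
    (hbound : ∀ n : ℕ, ∀ k : ℝ, 0 < k →
      a n ≤ C * (γ n * k + k ^ (2 * ρ) / (F n) ^ 2 + k ^ (-(2 * α)))) :
    ∃ C' : ℝ, 0 < C' ∧ ∀ n : ℕ,
      a n ≤ C' * ((γ n) ^ (2 * α / (2 * α + 1)) + (F n) ^ (-(2 * α / (α + ρ)))) := by
  refine ⟨2 * C, by positivity, fun n => ?_⟩
  have hg := hγpos n
  have hf := hFpos n
  have h₁ : 2 * α + 1 ≠ 0 := by positivity
  have h₂ : α + ρ ≠ 0 := by positivity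
  set k₁ := γ n ^ (-(1 / (2 * α + 1))) with hk₁
  set k₂ := F n ^ (1 / (α + ρ)) with hk₂
  have pos₁ : 0 < k₁ := Real.rpow_pos_of_pos hg _
  have pos₂ : 0 < k₂ := Real.rpow_pos_of_pos hf _
  have pos : 0 < min k₁ k₂ := lt_min pos₁ pos₂
  have stochastic : γ n * k₁ = γ n ^ (2 * α / (2 * α + 1)) := by
    rw [hk₁, ← Real.rpow_one_add' hg.le]
    · congr 1
      field_simp
      ring
    · have : 1 + -(1 / (2 * α + 1)) = 2 * α / (2 * α + 1) := by
        field_simp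
        ring
      rw [this]
      positivity
  have discretisation : k₂ ^ (2 * ρ) / F n ^ 2 = F n ^ (-(2 * α / (α + ρ))) := by
    rw [hk₂, ← Real.rpow_mul hf.le, ← Real.rpow_natCast, ← Real.rpow_sub hf]
    congr 1
    push_cast
    field_simp
    ring
  have approximation₁ : k₁ ^ (-(2 * α)) = γ n ^ (2 * α / (2 * α + 1)) := by
    rw [hk₁, ← Real.rpow_mul hg.le]
    congr 1
    field_simp
  have approximation₂ : k₂ ^ (-(2 * α)) = F n ^ (-(2 * α / (α + ρ))) := by
    rw [hk₂, ← Real.rpow_mul hf.le]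
    congr 1
    field_simp
  have bound₁ : γ n * min k₁ k₂ ≤ γ n ^ (2 * α / (2 * α + 1)) := by
    rw [← stochastic]
    gcongr
    exact min_le_left _ _
  have bound₂ : min k₁ k₂ ^ (2 * ρ) / F n ^ 2 ≤ F n ^ (-(2 * α / (α + ρ))) := by
    rw [← discretisation]
    gcongr
    exact min_le_right _ _
  have bound₃ : min k₁ k₂ ^ (-(2 * α)) ≤
      γ n ^ (2 * α / (2 * α + 1)) + F n ^ (-(2 * α / (α + ρ))) := by
    have nonneg₁ := Real.rpow_nonneg hg.le (2 * α / (2 * α + 1))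
    have nonneg₂ := Real.rpow_nonneg hf.le (-(2 * α / (α + ρ)))
    rcases min_choice k₁ k₂ with h | h
    · rw [h, approximation₁]
      linarith
    · rw [h, approximation₂]
      linarith
  calc a n ≤ C * (γ n * min k₁ k₂ + min k₁ k₂ ^ (2 * ρ) / F n ^ 2
        + min k₁ k₂ ^ (-(2 * α))) := hbound n _ pos
    _ ≤ C * (2 * (γ n ^ (2 * α / (2 * α + 1)) + F n ^ (-(2 * α / (α + ρ))))) := by
      gcongr
      linarith
    _ = _ := by ring
end

section
/- Let α ∈ (1, 2], L > 0, and let h : [0,1] → ℝ be differentiable with derivative h' satisfying |h'(x) − h'(y)| ≤ L·|x − y|^{α−1} for all x, y ∈ [0,1]. For an integer k ≥ 1 let S_k(h) : [0,1] → ℝ be the piecewise linear interpolant of h at the nodes x_i = i/k, i = 0,…,k, i.e. S_k(h)(x) = h(x_i) + (x − x_i)·(h(x_{i+1}) − h(x_i))/(x_{i+1} − x_i) for x ∈ [x_i, x_{i+1}]. Then there exists a constant C > 0, depending only on L and α, such that sup_{x∈[0,1]} |h(x) − S_k(h)(x)| ≤ C·k^{−α} for every integer k ≥ 1. -/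
/-- If `f'` stays within `M` of `f' a` on `[a, b]`, then `f` differs from its linear interpolant
at `a` and `b` by at most `2 * M * (b - a)` on `[a, b]`. -/
theorem abs_sub_linear_interpolant_le {f f' : ℝ → ℝ} {a b M : ℝ} (hab : a < b)
    (hf : ∀ x ∈ Set.Icc a b, HasDerivWithinAt f (f' x) (Set.Icc a b) x)
    (hM : ∀ x ∈ Set.Icc a b, |f' x - f' a| ≤ M) {x : ℝ} (hx : x ∈ Set.Icc a b) :
    |f x - (f a + (x - a) * ((f b - f a) / (b - a)))| ≤ 2 * M * (b - a) := by
  have ha : a ∈ Set.Icc a b := Set.left_mem_Icc.2 hab.le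
  have hM0 : 0 ≤ M := (abs_nonneg _).trans (hM a ha)
  have hba : 0 < b - a := sub_pos.2 hab
  have taylor : ∀ y ∈ Set.Icc a b, |f y - f a - (y - a) * f' a| ≤ M * (y - a) := by
    intro y hy
    have key := (convex_Icc a b).norm_image_sub_le_of_norm_hasDerivWithin_le
      (f := fun t => f t - t * f' a) (f' := fun t => f' t - 1 * f' a)
      (fun t ht => (hf t ht).sub ((hasDerivWithinAt_id t _).mul_const _))
      (fun t ht => by simpa using hM t ht) ha hy
    rw [Real.norm_eq_abs, Real.norm_eq_abs, abs_of_nonneg (sub_nonneg.2 hy.1)] at key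
    convert key using 2
    ring
  have hslope : |(f b - f a) / (b - a) - f' a| ≤ M := by
    have hb := taylor b (Set.right_mem_Icc.2 hab.le)
    rw [div_sub' hba.ne', abs_div, abs_of_pos hba, div_le_iff₀ hba]
    exact hb
  calc |f x - (f a + (x - a) * ((f b - f a) / (b - a)))|
      = |(f x - f a - (x - a) * f' a) - (x - a) * ((f b - f a) / (b - a) - f' a)| := by
        congr 1; ring
    _ ≤ |f x - f a - (x - a) * f' a| + |(x - a) * ((f b - f a) / (b - a) - f' a)| := abs_sub _ _
    _ ≤ M * (x - a) + (x - a) * M := by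
        rw [abs_mul, abs_of_nonneg (sub_nonneg.2 hx.1)]
        gcongr
        · exact taylor x hx
        · exact sub_nonneg.2 hx.1
    _ ≤ 2 * M * (b - a) := by nlinarith [hx.2]

/-- **Uniform error of piecewise linear interpolation of a `𝒞^α` function.**
Let `α ∈ (1,2]`, `L > 0`, and let `h : [0,1] → ℝ` be differentiable with derivative `h'`
satisfying `|h'(x) − h'(y)| ≤ L |x − y|^{α−1}`.  Then there is `C > 0`, depending only on
`L` and `α`, such that for every `k ≥ 1`, the piecewise linear interpolant of `h` at the
nodes `i/k` (given on `[i/k, (i+1)/k]` by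
`x ↦ h(i/k) + (x − i/k) (h((i+1)/k) − h(i/k)) / (1/k)`) differs from `h` by at most
`C k^{−α}` uniformly on `[0,1]`. -/
theorem piecewise_linear_interpolation_error (α L : ℝ)
    (hα1 : 1 < α) (hα2 : α ≤ 2) (hL : 0 < L) :
    ∃ C : ℝ, 0 < C ∧
      ∀ h h' : ℝ → ℝ,
        (∀ x ∈ Set.Icc (0 : ℝ) 1, HasDerivWithinAt h (h' x) (Set.Icc (0 : ℝ) 1) x) →
        (∀ x ∈ Set.Icc (0 : ℝ) 1, ∀ y ∈ Set.Icc (0 : ℝ) 1,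
          |h' x - h' y| ≤ L * |x - y| ^ (α - 1)) →
        ∀ k : ℕ, 1 ≤ k → ∀ i : ℕ, i < k →
          ∀ x ∈ Set.Icc ((i : ℝ) / k) (((i : ℝ) + 1) / k),
            |h x - (h ((i : ℝ) / k) +
              (x - (i : ℝ) / k) *
                ((h (((i : ℝ) + 1) / k) - h ((i : ℝ) / k)) /
                  (((i : ℝ) + 1) / k - (i : ℝ) / k)))| ≤
              C * (k : ℝ) ^ (-α) := by
  refine ⟨2 * L, by positivity, ?_⟩
  intro h h' hh hL' k hk i hi x hx
  have hk0 : (0 : ℝ) < k := by exact_mod_cast hk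
  have hlen : ((i : ℝ) + 1) / k - (i : ℝ) / k = (k : ℝ)⁻¹ := by
    field_simp
    ring
  have hab : (i : ℝ) / k < ((i : ℝ) + 1) / k := by
    gcongr
    linarith
  have hsub : Set.Icc ((i : ℝ) / k) (((i : ℝ) + 1) / k) ⊆ Set.Icc (0 : ℝ) 1 := by
    refine Set.Icc_subset_Icc (by positivity) ?_
    rw [div_le_one hk0]
    exact_mod_cast hi
  have hM : ∀ t ∈ Set.Icc ((i : ℝ) / k) (((i : ℝ) + 1) / k),
      |h' t - h' ((i : ℝ) / k)| ≤ L * ((k : ℝ)⁻¹) ^ (α - 1) := by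
    intro t ht
    refine (hL' t (hsub ht) _ (hsub (Set.left_mem_Icc.2 hab.le))).trans ?_
    rw [abs_of_nonneg (sub_nonneg.2 ht.1)]
    have := sub_nonneg.2 ht.1
    gcongr
    linarith [ht.2]
  refine (abs_sub_linear_interpolant_le hab
    (fun t ht => (hh t (hsub ht)).mono hsub) hM hx).trans_eq ?_
  have hpow : ((k : ℝ)⁻¹) ^ (α - 1) * (k : ℝ)⁻¹ = (k : ℝ) ^ (-α) := by
    rw [← Real.rpow_add_one (inv_pos.2 hk0).ne', sub_add_cancel, Real.inv_rpow hk0.le,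
      Real.rpow_neg hk0.le]
  rw [hlen, ← hpow]
  ring
end

section
/- Let α ∈ (1, 2], L > 0, and let h : [0,1] → ℝ be differentiable with derivative h' satisfying |h'(x) − h'(y)| ≤ L·|x − y|^{α−1} for all x, y ∈ [0,1]. Let c₁, c₂ ∈ ℝ and define the horizon function f : [0,1]² → ℝ by f(x, y) = c₁ if y ≤ h(x) and f(x, y) = c₂ if y > h(x). For an integer k ≥ 1 let S_k(h) be the piecewise linear interpolant of h at the nodes i/k, i = 0,…,k, and define f_k : [0,1]² → ℝ by f_k(x, y) = c₁ if y ≤ S_k(h)(x) and f_k(x, y) = c₂ if y > S_k(h)(x). Then ‖f − f_k‖_{L²([0,1]²)} ≤ |c₁ − c₂|·(sup_{x∈[0,1]} |h(x) − S_k(h)(x)|)^{1/2}, and consequently there is a constant C > 0, depending only on L, α and |c₁ − c₂|, such that ‖f − f_k‖_{L²([0,1]²)} ≤ C·k^{−α/2} for every integer k ≥ 1. -/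
/-- The piecewise linear interpolant `S_k(h)` of `h : [0,1] → ℝ` at the nodes `i/k`,
`i = 0,…,k`: on `[i/k, (i+1)/k]` it is the affine function
`x ↦ h(i/k) + (x − i/k)·(h((i+1)/k) − h(i/k))/((i+1)/k − i/k)`. -/
noncomputable def linInterp (h : ℝ → ℝ) (k : ℕ) (x : ℝ) : ℝ :=
  let i : ℕ := min ⌊x * k⌋₊ (k - 1)
  h ((i : ℝ) / k) +
    (x - (i : ℝ) / k) *
      ((h (((i : ℝ) + 1) / k) - h ((i : ℝ) / k)) / (((i : ℝ) + 1) / k - (i : ℝ) / k))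

open MeasureTheory Set in
/-- Two-dimensional horizon functions whose boundaries are uniformly `M`-close on `[0,1]` have
squared `L²` distance at most `(c₁ - c₂)² M`.  No measurability of the boundaries is needed. -/
theorem setIntegral_horizon_sub_sq_le (u v : ℝ → ℝ) (c₁ c₂ M : ℝ)
    (huv : ∀ x ∈ Icc (0 : ℝ) 1, |u x - v x| ≤ M) :
    ∫ p in (Icc (0 : ℝ) 1 ×ˢ Icc (0 : ℝ) 1),
        ((if p.2 ≤ u p.1 then c₁ else c₂) - (if p.2 ≤ v p.1 then c₁ else c₂)) ^ 2 ≤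
      (c₁ - c₂) ^ 2 * M := by
  have hM : 0 ≤ M := (abs_nonneg _).trans (huv 0 (by simp))
  have slice_le (a b : ℝ) : ∫ y in Icc (0 : ℝ) 1,
      ((if y ≤ a then c₁ else c₂) - (if y ≤ b then c₁ else c₂)) ^ 2 ≤ (c₁ - c₂) ^ 2 * |a - b| := by
    have hstrip : Integrable ((Ioc (min a b) (max a b)).indicator fun _ ↦ (c₁ - c₂) ^ 2) :=
      (integrable_indicator_iff measurableSet_Ioc).2 (integrableOn_const (by simp))
    calc
      _ ≤ ∫ y in Icc (0 : ℝ) 1, (Ioc (min a b) (max a b)).indicator (fun _ ↦ (c₁ - c₂) ^ 2) y := by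
        refine integral_mono_of_nonneg (.of_forall fun _ ↦ sq_nonneg _) hstrip.integrableOn
          (.of_forall fun y ↦ ?_)
        simp only [indicator_apply, mem_Ioc, min_lt_iff, le_max_iff]
        split_ifs <;> grind
      _ ≤ ∫ y, (Ioc (min a b) (max a b)).indicator (fun _ ↦ (c₁ - c₂) ^ 2) y :=
        setIntegral_le_integral hstrip (.of_forall fun _ ↦ indicator_nonneg (fun _ _ ↦ sq_nonneg _) _)
      _ = (c₁ - c₂) ^ 2 * |a - b| := by
        rw [integral_indicator measurableSet_Ioc, setIntegral_const, measureReal_def,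
          Real.volume_Ioc, max_sub_min_eq_abs', ENNReal.toReal_ofReal (abs_nonneg _), smul_eq_mul,
          mul_comm]
  by_cases hF : IntegrableOn (fun p : ℝ × ℝ ↦
      ((if p.2 ≤ u p.1 then c₁ else c₂) - (if p.2 ≤ v p.1 then c₁ else c₂)) ^ 2)
      (Icc (0 : ℝ) 1 ×ˢ Icc (0 : ℝ) 1)
  · rw [Measure.volume_eq_prod] at hF ⊢
    rw [setIntegral_prod _ hF]
    have hbound := norm_setIntegral_le_of_norm_le_const (μ := volume) (s := Icc (0 : ℝ) 1)
      (C := (c₁ - c₂) ^ 2 * M) (f := fun x ↦ ∫ y in Icc (0 : ℝ) 1,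
        ((if y ≤ u x then c₁ else c₂) - (if y ≤ v x then c₁ else c₂)) ^ 2) (by simp)
      fun x hx ↦ by
        rw [Real.norm_of_nonneg (integral_nonneg fun _ ↦ sq_nonneg _)]
        exact (slice_le _ _).trans (mul_le_mul_of_nonneg_left (huv x hx) (sq_nonneg _))
    simpa using (le_abs_self _).trans hbound
  · rw [integral_undef hF]
    positivity

open Set in
/-- The error of affine interpolation of a function with `(α - 1)`-Hölder derivative. -/
theorem abs_sub_affine_interpolation_le {α L a b x : ℝ} (hα : 1 ≤ α) (hL : 0 ≤ L) {h h' : ℝ → ℝ}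
    (hcont : ContinuousOn h (Icc a b)) (hderiv : ∀ x ∈ Ioo a b, HasDerivAt h (h' x) x)
    (hholder : ∀ x ∈ Ioo a b, ∀ y ∈ Ioo a b, |h' x - h' y| ≤ L * |x - y| ^ (α - 1))
    (hab : a < b) (hx : x ∈ Icc a b) :
    |h x - (h a + (x - a) * ((h b - h a) / (b - a)))| ≤ L * (b - a) ^ α := by
  have hpos : 0 < b - a := sub_pos.2 hab
  rcases hx.1.eq_or_lt with rfl | hax
  · simpa using mul_nonneg hL (Real.rpow_nonneg hpos.le _)
  obtain ⟨ξ, hξ, hξ'⟩ := exists_hasDerivAt_eq_slope h h' hax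
    (hcont.mono (Icc_subset_Icc_right hx.2)) fun y hy ↦ hderiv y ⟨hy.1, hy.2.trans_le hx.2⟩
  obtain ⟨η, hη, hη'⟩ := exists_hasDerivAt_eq_slope h h' hab hcont hderiv
  have hξm : ξ ∈ Ioo a b := ⟨hξ.1, hξ.2.trans_le hx.2⟩
  have herr : h x - (h a + (x - a) * ((h b - h a) / (b - a))) = (x - a) * (h' ξ - h' η) := by
    rw [hξ', ← hη', mul_sub, mul_div_cancel₀ _ (sub_pos.2 hax).ne']
    ring
  have hdist : |ξ - η| ≤ b - a :=
    abs_sub_le_iff.2 ⟨by linarith [hξm.2, hη.1], by linarith [hξm.1, hη.2]⟩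
  rw [herr, abs_mul, abs_of_pos (sub_pos.2 hax)]
  calc
    (x - a) * |h' ξ - h' η| ≤ (b - a) * (L * (b - a) ^ (α - 1)) := by
      refine mul_le_mul (by linarith [hx.2]) ?_ (abs_nonneg _) hpos.le
      exact (hholder ξ hξm η hη).trans (mul_le_mul_of_nonneg_left
        (Real.rpow_le_rpow (abs_nonneg _) hdist (by linarith)) hL)
    _ = L * (b - a) ^ α := by
      rw [Real.rpow_sub_one hpos.ne']
      field_simp

open Set in
/-- The error of piecewise linear interpolation on the uniform grid of mesh `1 / k`. -/
theorem abs_sub_linInterp_le {α L : ℝ} (hα : 1 ≤ α) (hL : 0 ≤ L) {h h' : ℝ → ℝ}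
    (hderiv : ∀ x ∈ Icc (0 : ℝ) 1, HasDerivWithinAt h (h' x) (Icc (0 : ℝ) 1) x)
    (hholder : ∀ x ∈ Icc (0 : ℝ) 1, ∀ y ∈ Icc (0 : ℝ) 1, |h' x - h' y| ≤ L * |x - y| ^ (α - 1))
    {k : ℕ} (hk : 1 ≤ k) {x : ℝ} (hx : x ∈ Icc (0 : ℝ) 1) :
    |h x - linInterp h k x| ≤ L * (k : ℝ) ^ (-α) := by
  have hk0 : (0 : ℝ) < k := by exact_mod_cast hk
  unfold linInterp
  set i : ℕ := min ⌊x * k⌋₊ (k - 1) with hi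
  have hxk : 0 ≤ x * k := mul_nonneg hx.1 hk0.le
  have hleft : (i : ℝ) / k ≤ x := by
    rw [div_le_iff₀ hk0]
    exact (Nat.cast_le.2 (min_le_left _ _)).trans (Nat.floor_le hxk)
  have hright : x ≤ ((i : ℝ) + 1) / k := by
    rw [le_div_iff₀ hk0]
    rcases le_total ⌊x * k⌋₊ (k - 1) with hle | hle
    · rw [hi, min_eq_left hle]
      exact (Nat.lt_floor_add_one _).le
    · rw [hi, min_eq_right hle, Nat.cast_sub hk]
      simpa using mul_le_of_le_one_left hk0.le hx.2
  have hi1 : ((i : ℝ) + 1) / k ≤ 1 := by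
    rw [div_le_one hk0]
    exact_mod_cast (show i + 1 ≤ k by omega)
  have hi0 : 0 ≤ (i : ℝ) / k := by positivity
  have hmesh : ((i : ℝ) + 1) / k - i / k = (k : ℝ)⁻¹ := by ring
  have hsub : Icc ((i : ℝ) / k) (((i : ℝ) + 1) / k) ⊆ Icc 0 1 := Icc_subset_Icc hi0 hi1
  have hsub' := Ioo_subset_Icc_self.trans hsub
  have hbound := abs_sub_affine_interpolation_le hα hL
    (HasDerivWithinAt.continuousOn hderiv |>.mono hsub)
    (fun y hy ↦ (hderiv y (hsub' hy)).hasDerivAt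
      (Icc_mem_nhds (hi0.trans_lt hy.1) (hy.2.trans_le hi1)))
    (fun y hy z hz ↦ hholder y (hsub' hy) z (hsub' hz))
    (sub_pos.1 (hmesh ▸ inv_pos.2 hk0)) ⟨hleft, hright⟩
  refine hbound.trans_eq ?_
  rw [hmesh, Real.inv_rpow hk0.le, Real.rpow_neg hk0.le]

/-- **L² error of the interpolated horizon function.**
Let `α ∈ (1,2]`, `L > 0`, `h ∈ 𝒞^α([0,1])` (derivative `(α−1)`-Hölder with constant `L`),
and let `f` be the horizon function equal to `c₁` below the graph of `h` and `c₂` above,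
`f_k` the analogous function for the interpolant `S_k(h)`.  Then
`‖f − f_k‖_{L²([0,1]²)} ≤ |c₁ − c₂| (sup_{x ∈ [0,1]} |h(x) − S_k(h)(x)|)^{1/2}`, and
consequently `‖f − f_k‖_{L²([0,1]²)} ≤ C k^{−α/2}` with `C` depending only on `L`, `α`
and `|c₁ − c₂|`. -/
theorem horizon_function_L2_error (α L : ℝ)
    (hα1 : 1 < α) (hα2 : α ≤ 2) (hL : 0 < L) (c₁ c₂ : ℝ) :
    ∃ C : ℝ, 0 < C ∧
      ∀ h h' : ℝ → ℝ,
        (∀ x ∈ Set.Icc (0 : ℝ) 1, HasDerivWithinAt h (h' x) (Set.Icc (0 : ℝ) 1) x) →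
        (∀ x ∈ Set.Icc (0 : ℝ) 1, ∀ y ∈ Set.Icc (0 : ℝ) 1,
          |h' x - h' y| ≤ L * |x - y| ^ (α - 1)) →
        ∀ k : ℕ, 1 ≤ k →
          Real.sqrt (∫ p in (Set.Icc (0 : ℝ) 1 ×ˢ Set.Icc (0 : ℝ) 1),
              ((if p.2 ≤ h p.1 then c₁ else c₂) -
               (if p.2 ≤ linInterp h k p.1 then c₁ else c₂)) ^ 2) ≤
            |c₁ - c₂| *
              Real.sqrt (⨆ x ∈ Set.Icc (0 : ℝ) 1, |h x - linInterp h k x|) ∧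
          Real.sqrt (∫ p in (Set.Icc (0 : ℝ) 1 ×ˢ Set.Icc (0 : ℝ) 1),
              ((if p.2 ≤ h p.1 then c₁ else c₂) -
               (if p.2 ≤ linInterp h k p.1 then c₁ else c₂)) ^ 2) ≤
            C * (k : ℝ) ^ (-(α / 2)) := by
  refine ⟨|c₁ - c₂| * √L + 1, by positivity, fun h h' hderiv hholder k hk ↦ ?_⟩
  have hk0 : (0 : ℝ) < k := by exact_mod_cast hk
  set B : ℝ := L * (k : ℝ) ^ (-α)
  have hB : 0 ≤ B := by positivity
  have herr (x : ℝ) (hx : x ∈ Set.Icc (0 : ℝ) 1) : |h x - linInterp h k x| ≤ B :=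
    abs_sub_linInterp_le hα1.le hL.le hderiv hholder hk hx
  have hle (x : ℝ) : ⨆ _ : x ∈ Set.Icc (0 : ℝ) 1, |h x - linInterp h k x| ≤ B :=
    Real.iSup_le (herr x) hB
  have hle_sup (x : ℝ) (hx : x ∈ Set.Icc (0 : ℝ) 1) : |h x - linInterp h k x| ≤
      ⨆ x ∈ Set.Icc (0 : ℝ) 1, |h x - linInterp h k x| := by
    refine le_trans ?_ (le_ciSup ⟨B, Set.forall_mem_range.2 hle⟩ x)
    rw [ciSup_pos hx]
  have hsqrt {M : ℝ} (hM : ∀ x ∈ Set.Icc (0 : ℝ) 1, |h x - linInterp h k x| ≤ M) :=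
    (Real.sqrt_le_sqrt (setIntegral_horizon_sub_sq_le h (linInterp h k) c₁ c₂ M hM)).trans_eq
      (by rw [Real.sqrt_mul (sq_nonneg _), Real.sqrt_sq_eq_abs])
  refine ⟨hsqrt hle_sup, (hsqrt herr).trans ?_⟩
  have hpow : √((k : ℝ) ^ (-α)) = (k : ℝ) ^ (-(α / 2)) := by
    rw [Real.sqrt_eq_rpow, ← Real.rpow_mul hk0.le]
    ring_nf
  rw [Real.sqrt_mul hL.le, hpow, ← mul_assoc]
  exact mul_le_mul_of_nonneg_right (by linarith) (by positivity)
end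

section
/- Let n ≥ 1 be an integer and let g : [0,1] → ℝ be continuous on [0,1], differentiable on (0,1), with derivative g' square integrable on (0,1) and satisfying g(b) − g(a) = ∫_a^b g'(u) du for all 0 ≤ a ≤ b ≤ 1. Let ḡ : [0,1) → ℝ be the piecewise constant function whose value on each interval [(i−1)/n, i/n), i = 1,…,n, equals the mean n·∫_{(i−1)/n}^{i/n} g(u) du. Then ‖g − ḡ‖_{L²((0,1))} ≤ (1/n)·‖g'‖_{L²((0,1))}. -/
open MeasureTheory intervalIntegral

/-- The discretization of `g` by local means on the uniform partition of `[0,1)` into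
`n` intervals: on `[i/n, (i+1)/n)` its value is `n ∫_{i/n}^{(i+1)/n} g`. -/
noncomputable def localMeans (n : ℕ) (g : ℝ → ℝ) (x : ℝ) : ℝ :=
  (n : ℝ) * ∫ u in ((⌊x * n⌋₊ : ℝ) / n)..(((⌊x * n⌋₊ : ℝ) + 1) / n), g u

/-- Cauchy–Schwarz against the constant function `1` on an interval. -/
theorem sq_intervalIntegral_le {f : ℝ → ℝ} {a b : ℝ} (hab : a ≤ b)
    (hf : IntervalIntegrable f volume a b)
    (hf2 : IntervalIntegrable (fun x => f x ^ 2) volume a b) :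
    (∫ x in a..b, f x) ^ 2 ≤ (b - a) * ∫ x in a..b, f x ^ 2 := by
  rcases hab.eq_or_lt with rfl | hlt
  · simp
  set I := ∫ x in a..b, f x with hI
  have hnonneg : 0 ≤ ∫ x in a..b, ((b - a) * f x - I) ^ 2 :=
    intervalIntegral.integral_nonneg hab fun _ _ => sq_nonneg _
  have hexpand : ∫ x in a..b, ((b - a) * f x - I) ^ 2
      = (b - a) ^ 2 * (∫ x in a..b, f x ^ 2) - 2 * (b - a) * I * I + (b - a) * I ^ 2 := by
    have : (fun x => ((b - a) * f x - I) ^ 2)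
        = fun x => ((b - a) ^ 2 * f x ^ 2 - 2 * (b - a) * I * f x) + I ^ 2 := by
      ext x; ring
    rw [this, intervalIntegral.integral_add
        ((hf2.const_mul _).sub (hf.const_mul _)) intervalIntegrable_const,
      intervalIntegral.integral_sub (hf2.const_mul _) (hf.const_mul _),
      intervalIntegral.integral_const_mul, intervalIntegral.integral_const_mul,
      intervalIntegral.integral_const, smul_eq_mul]
  have hpos : 0 < b - a := sub_pos.2 hlt
  have : 0 ≤ (b - a) * ((b - a) * (∫ x in a..b, f x ^ 2) - I ^ 2) := by
    rw [hexpand] at hnonneg; linarith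
  linarith [nonneg_of_mul_nonneg_right this hpos]

/-- An increment of a primitive of `f` inside `[a, b]` is controlled by the `L²` norm of `f`. -/
theorem sq_sub_le_of_forall_sub_eq_integral {g f : ℝ → ℝ} {a b : ℝ}
    (hf : IntervalIntegrable f volume a b)
    (hf2 : IntervalIntegrable (fun x => f x ^ 2) volume a b)
    (hftc : ∀ c d : ℝ, a ≤ c → c ≤ d → d ≤ b → g d - g c = ∫ u in c..d, f u)
    {x y : ℝ} (hx : x ∈ Set.Icc a b) (hy : y ∈ Set.Icc a b) :
    (g x - g y) ^ 2 ≤ (b - a) * ∫ u in a..b, f u ^ 2 := by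
  wlog hyx : y ≤ x generalizing x y
  · rw [sub_sq_comm]
    exact this hy hx (le_of_not_ge hyx)
  have hab : a ≤ b := hx.1.trans hx.2
  have hsub : Set.uIcc y x ⊆ Set.uIcc a b := by
    rw [Set.uIcc_of_le hyx, Set.uIcc_of_le hab]
    exact Set.Icc_subset_Icc hy.1 hx.2
  rw [hftc y x hy.1 hyx hx.2]
  refine (sq_intervalIntegral_le hyx (hf.mono_set hsub) (hf2.mono_set hsub)).trans ?_
  refine mul_le_mul (by linarith [hx.2, hy.1]) ?_
    (intervalIntegral.integral_nonneg hyx fun _ _ => sq_nonneg _) (by linarith)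
  exact intervalIntegral.integral_mono_interval hy.1 hyx hx.2
    (Filter.Eventually.of_forall fun _ => sq_nonneg _) hf2

/-- Poincaré–Wirtinger inequality on `[a, b]`, with constant `b - a`. -/
theorem integral_sq_sub_average_le {g f : ℝ → ℝ} {a b : ℝ} (hab : a < b)
    (hg : ContinuousOn g (Set.Icc a b))
    (hf : IntervalIntegrable f volume a b)
    (hf2 : IntervalIntegrable (fun x => f x ^ 2) volume a b)
    (hftc : ∀ c d : ℝ, a ≤ c → c ≤ d → d ≤ b → g d - g c = ∫ u in c..d, f u) :
    ∫ x in a..b, (g x - (b - a)⁻¹ * ∫ u in a..b, g u) ^ 2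
      ≤ (b - a) ^ 2 * ∫ u in a..b, f u ^ 2 := by
  set M := (b - a) * ∫ u in a..b, f u ^ 2 with hM
  have hpos : 0 < b - a := sub_pos.2 hab
  have hM0 : 0 ≤ M :=
    mul_nonneg hpos.le (intervalIntegral.integral_nonneg hab.le fun _ _ => sq_nonneg _)
  have hgi : IntervalIntegrable g volume a b :=
    ContinuousOn.intervalIntegrable (by rwa [Set.uIcc_of_le hab.le])
  have hpt : ∀ x ∈ Set.Icc a b, (g x - (b - a)⁻¹ * ∫ u in a..b, g u) ^ 2 ≤ M := by
    intro x hx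
    have hbound : ‖∫ u in a..b, (g x - g u)‖ ≤ √M * |b - a| := by
      refine intervalIntegral.norm_integral_le_of_norm_le_const fun u hu => ?_
      rw [Set.uIoc_of_le hab.le] at hu
      exact Real.abs_le_sqrt
        (sq_sub_le_of_forall_sub_eq_integral hf hf2 hftc hx (Set.Ioc_subset_Icc_self hu))
    rw [intervalIntegral.integral_sub intervalIntegrable_const hgi,
      intervalIntegral.integral_const, smul_eq_mul, Real.norm_eq_abs, abs_of_pos hpos] at hbound
    have heq : g x - (b - a)⁻¹ * ∫ u in a..b, g u
        = (b - a)⁻¹ * ((b - a) * g x - ∫ u in a..b, g u) := by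
      field_simp
    have habs : |g x - (b - a)⁻¹ * ∫ u in a..b, g u| ≤ √M := by
      rw [heq, abs_mul, abs_of_pos (inv_pos.2 hpos), inv_mul_le_iff₀ hpos, mul_comm _ (√M)]
      exact hbound
    rw [← Real.sq_sqrt hM0]
    exact sq_le_sq' (abs_le.1 habs).1 (abs_le.1 habs).2
  calc ∫ x in a..b, (g x - (b - a)⁻¹ * ∫ u in a..b, g u) ^ 2
      ≤ ∫ _ in a..b, M := by
        refine intervalIntegral.integral_mono_on hab.le ?_ intervalIntegrable_const hpt
        refine ContinuousOn.intervalIntegrable ?_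
        rw [Set.uIcc_of_le hab.le]
        exact (hg.sub continuousOn_const).pow 2
    _ = (b - a) ^ 2 * ∫ u in a..b, f u ^ 2 := by
        rw [intervalIntegral.integral_const, smul_eq_mul, hM]; ring

/-- On the open cell `(i/n, (i+1)/n)`, `localMeans n g` is the mean of `g` over that cell. -/
theorem localMeans_eq_of_mem_Ioo {n : ℕ} (hn : 1 ≤ n) (g : ℝ → ℝ) (i : ℕ) {x : ℝ}
    (hx : x ∈ Set.Ioo ((i : ℝ) / n) (((i + 1 : ℕ) : ℝ) / n)) :
    localMeans n g x
      = (((i + 1 : ℕ) : ℝ) / n - (i : ℝ) / n)⁻¹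
        * ∫ u in ((i : ℝ) / n)..(((i + 1 : ℕ) : ℝ) / n), g u := by
  have hn0 : (0 : ℝ) < n := by exact_mod_cast hn
  have hlo : (i : ℝ) < x * n := (div_lt_iff₀ hn0).1 hx.1
  have hhi : x * n < ((i + 1 : ℕ) : ℝ) := (lt_div_iff₀ hn0).1 hx.2
  have hfloor : ⌊x * n⌋₊ = i := by
    rw [Nat.floor_eq_iff (i.cast_nonneg.trans hlo.le)]
    exact ⟨hlo.le, by exact_mod_cast hhi⟩
  have hlen : (((i + 1 : ℕ) : ℝ) / n - (i : ℝ) / n)⁻¹ = n := by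
    push_cast; field_simp; ring
  rw [localMeans, hfloor, hlen]
  push_cast
  rfl

/-- **Discretization error for absolutely continuous functions.**
Let `g : [0,1] → ℝ` be continuous, differentiable on `(0,1)` with square-integrable
derivative `g'` satisfying the fundamental theorem of calculus, and let `ḡ` be the
piecewise constant function of local means of `g` on the `n` intervals `[(i−1)/n, i/n)`.
Then `‖g − ḡ‖_{L²((0,1))} ≤ (1/n) ‖g'‖_{L²((0,1))}`. -/
theorem localMeans_L2_error (n : ℕ) (hn : 1 ≤ n) (g g' : ℝ → ℝ)
    (hcont : ContinuousOn g (Set.Icc (0 : ℝ) 1))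
    (hderiv : ∀ x ∈ Set.Ioo (0 : ℝ) 1, HasDerivAt g (g' x) x)
    (hint : IntegrableOn g' (Set.Ioo (0 : ℝ) 1))
    (hsq : IntegrableOn (fun x => (g' x) ^ 2) (Set.Ioo (0 : ℝ) 1))
    (hftc : ∀ a b : ℝ, 0 ≤ a → a ≤ b → b ≤ 1 → g b - g a = ∫ u in a..b, g' u) :
    Real.sqrt (∫ x in Set.Ioo (0 : ℝ) 1, (g x - localMeans n g x) ^ 2) ≤
      (1 / n) * Real.sqrt (∫ x in Set.Ioo (0 : ℝ) 1, (g' x) ^ 2) := by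
  have hn0 : (0 : ℝ) < n := by exact_mod_cast hn
  let t : ℕ → ℝ := fun i => (i : ℝ) / n
  have ht0 : t 0 = 0 := by simp [t]
  have htn : t n = 1 := div_self hn0.ne'
  have hlt (i : ℕ) : t i < t (i + 1) :=
    div_lt_div_of_pos_right (by exact_mod_cast i.lt_succ_self) hn0
  have hlen (i : ℕ) : t (i + 1) - t i = 1 / n := by
    simp only [t]; push_cast; ring
  have hnonneg (i : ℕ) : 0 ≤ t i := by positivity
  have hle_one {i : ℕ} (hi : i < n) : t (i + 1) ≤ 1 :=
    (div_le_one hn0).2 (by exact_mod_cast hi)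
  have hunit {f : ℝ → ℝ} (hf : IntegrableOn f (Set.Ioo (0 : ℝ) 1)) :
      ∀ i < n, IntervalIntegrable f volume (t i) (t (i + 1)) := fun i hi =>
    (intervalIntegrable_iff_integrableOn_Ioo_of_le (hlt i).le).2
      (hf.mono_set (Set.Ioo_subset_Ioo (hnonneg i) (hle_one hi)))
  have hcell (i : ℕ) (hi : i < n) : ContinuousOn g (Set.Icc (t i) (t (i + 1))) :=
    hcont.mono (Set.Icc_subset_Icc (hnonneg i) (hle_one hi))
  have hEq (i : ℕ) : Set.EqOn (fun x => (g x - localMeans n g x) ^ 2)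
      (fun x => (g x - (t (i + 1) - t i)⁻¹ * ∫ u in (t i)..(t (i + 1)), g u) ^ 2)
      (Set.Ioo (t i) (t (i + 1))) := fun x hx => by
    simp only [localMeans_eq_of_mem_Ioo hn g i hx, t]
  have herr (i : ℕ) (hi : i < n) : IntervalIntegrable
      (fun x => (g x - localMeans n g x) ^ 2) volume (t i) (t (i + 1)) := by
    rw [intervalIntegrable_iff_integrableOn_Ioo_of_le (hlt i).le]
    refine IntegrableOn.congr_fun ?_ (hEq i).symm measurableSet_Ioo
    exact (((hcell i hi).sub continuousOn_const).pow 2).integrableOn_Icc.mono_set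
      Set.Ioo_subset_Icc_self
  have hbound (i : ℕ) (hi : i < n) :
      ∫ x in (t i)..(t (i + 1)), (g x - localMeans n g x) ^ 2
        ≤ (1 / n : ℝ) ^ 2 * ∫ x in (t i)..(t (i + 1)), g' x ^ 2 := by
    have hcongr : ∫ x in (t i)..(t (i + 1)), (g x - localMeans n g x) ^ 2
        = ∫ x in (t i)..(t (i + 1)),
            (g x - (t (i + 1) - t i)⁻¹ * ∫ u in (t i)..(t (i + 1)), g u) ^ 2 :=
      integral_congr_Ioo_of_le (hlt i).le (hEq i)
    rw [hcongr, ← hlen i]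
    exact integral_sq_sub_average_le (hlt i) (hcell i hi) (hunit hint i hi) (hunit hsq i hi)
      fun c d hc hcd hd => hftc c d ((hnonneg i).trans hc) hcd (hd.trans (hle_one hi))
  have hsum {f : ℝ → ℝ} (hf : ∀ i < n, IntervalIntegrable f volume (t i) (t (i + 1))) :
      ∫ x in Set.Ioo (0 : ℝ) 1, f x
        = ∑ i ∈ Finset.range n, ∫ x in (t i)..(t (i + 1)), f x := by
    rw [sum_integral_adjacent_intervals hf, ht0, htn, integral_of_le zero_le_one,
      integral_Ioc_eq_integral_Ioo]
  have hmain : ∫ x in Set.Ioo (0 : ℝ) 1, (g x - localMeans n g x) ^ 2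
      ≤ (1 / n : ℝ) ^ 2 * ∫ x in Set.Ioo (0 : ℝ) 1, g' x ^ 2 := by
    rw [hsum herr, hsum (hunit hsq), Finset.mul_sum]
    exact Finset.sum_le_sum fun i hi => hbound i (Finset.mem_range.1 hi)
  refine (Real.sqrt_le_sqrt hmain).trans_eq ?_
  rw [Real.sqrt_mul (sq_nonneg _), Real.sqrt_sq (by positivity)]
end
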